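/- Let μ be a p×p general closed interval matrix. Then μ is full-rank if and only if the matrix μ̃ (obtained from μ by replacing every entry equal to (−∞, +∞) with the constant 0) is full-rank and, for every pair (i,j) such that μ_{i,j} = (−∞, +∞), one has Mrk(μ_{î,ĵ}) < p − 1, where μ_{î,ĵ} is the (p−1)×(p−1) general closed interval matrix obtained from μ by deleting row i and column j. -/

import Mathlib

open scoped Classical

/-- A real matrix `A` is contained in the (general closed interval) matrix `μ` of subsets
of `ℝ` iff each entry of `A` belongs to the corresponding entry of `μ`. -/
def Contains {I J : Type*} (μ : Matrix I J (Set ℝ)) (A : Matrix I J ℝ) : Prop :=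
  ∀ i j, A i j ∈ μ i j

/-- `μ` is a general closed interval matrix: every entry is a closed connected nonempty
subset of `ℝ`. -/
def GCIM {I J : Type*} (μ : Matrix I J (Set ℝ)) : Prop :=
  ∀ i j, IsClosed (μ i j) ∧ (μ i j).Nonempty ∧ IsPreconnected (μ i j)

/-- The maximal rank `Mrk(μ)` of a general closed interval matrix. -/
noncomputable def Mrk {I J : Type*} [Fintype I] [Fintype J] (μ : Matrix I J (Set ℝ)) : ℕ :=
  sSup {t : ℕ | ∃ A : Matrix I J ℝ, Contains μ A ∧ A.rank = t}

/-- `μ̃`: the matrix obtained from `μ` by replacing every entry equal to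
`(-∞, +∞) = Set.univ` with the constant `{0}`. -/
noncomputable def tildeM {I J : Type*} (μ : Matrix I J (Set ℝ)) : Matrix I J (Set ℝ) :=
  Matrix.of fun i j => if μ i j = Set.univ then ({0} : Set ℝ) else μ i j

theorem Matrix.det_sub_det_of_eq_off_entry {p : ℕ}
    {A B : Matrix (Fin (p + 1)) (Fin (p + 1)) ℝ} (i j : Fin (p + 1))
    (h : ∀ k l, (k, l) ≠ (i, j) → A k l = B k l) :
    A.det - B.det = (-1) ^ (i + j : ℕ) * (A i j - B i j) *
      (A.submatrix i.succAbove j.succAbove).det := by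
  have hsub : ∀ l, A.submatrix i.succAbove (Fin.succAbove l) =
      B.submatrix i.succAbove (Fin.succAbove l) := by
    intro l
    ext a b
    exact h _ _ fun e => Fin.succAbove_ne i a (Prod.ext_iff.1 e).1
  rw [Matrix.det_succ_row A i, Matrix.det_succ_row B i, ← Finset.sum_sub_distrib,
    Finset.sum_eq_single j]
  · rw [← hsub]; ring
  · intro l _ hl
    rw [hsub, h i l fun e => hl (Prod.ext_iff.1 e).2, sub_self]
  · simp

theorem Matrix.rank_eq_card_iff_det_ne_zero {p : ℕ} (A : Matrix (Fin p) (Fin p) ℝ) :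
    A.rank = p ↔ A.det ≠ 0 := by
  rw [← isUnit_iff_ne_zero, ← Matrix.isUnit_iff_isUnit_det]
  constructor
  · intro h
    rw [← Matrix.linearIndependent_rows_iff_isUnit, linearIndependent_iff_card_eq_finrank_span,
      Set.finrank, ← Matrix.rank_eq_finrank_span_row, h, Fintype.card_fin]
  · intro h
    rw [Matrix.rank_of_isUnit A h, Fintype.card_fin]

theorem Mrk_lt_iff_forall_det_eq_zero {p : ℕ} {ν : Matrix (Fin p) (Fin p) (Set ℝ)}
    (hν : ∀ i j, (ν i j).Nonempty) :
    Mrk ν < p ↔ ∀ B, Contains ν B → B.det = 0 := by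
  have hbdd : BddAbove {t : ℕ | ∃ A : Matrix (Fin p) (Fin p) ℝ, Contains ν A ∧ A.rank = t} := by
    refine ⟨p, ?_⟩
    rintro t ⟨A, -, rfl⟩
    exact A.rank_le_height
  constructor
  · intro h B hB
    by_contra hdet
    have hle : B.rank ≤ Mrk ν := le_csSup hbdd ⟨B, hB, rfl⟩
    rw [B.rank_eq_card_iff_det_ne_zero.2 hdet] at hle
    omega
  · intro h
    choose C hC using hν
    obtain ⟨B, hB, hrank⟩ : Mrk ν ∈
        {t : ℕ | ∃ A : Matrix (Fin p) (Fin p) ℝ, Contains ν A ∧ A.rank = t} :=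
      Nat.sSup_mem ⟨_, Matrix.of C, hC, rfl⟩ hbdd
    rw [← hrank]
    exact lt_of_le_of_ne B.rank_le_height
      fun e => B.rank_eq_card_iff_det_ne_zero.1 e (h B hB)

/-- Every matrix contained in a submatrix of `μ` obtained by deleting a row and a column
extends to a matrix contained in `μ`. -/
theorem Contains.exists_extension {p : ℕ} {μ : Matrix (Fin (p + 1)) (Fin (p + 1)) (Set ℝ)}
    (hμ : ∀ i j, (μ i j).Nonempty) {i j : Fin (p + 1)} {B : Matrix (Fin p) (Fin p) ℝ}
    (hB : Contains (μ.submatrix i.succAbove j.succAbove) B) :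
    ∃ A, Contains μ A ∧ A.submatrix i.succAbove j.succAbove = B := by
  choose C hC using hμ
  refine ⟨Matrix.of (i.insertNth (C i) fun a => j.insertNth (C (i.succAbove a) j) (B a)), ?_, ?_⟩
  · intro k l
    refine Fin.succAboveCases i ?_ (fun a => ?_) k
    · simpa using hC i l
    · refine Fin.succAboveCases j ?_ (fun b => ?_) l
      · simpa using hC (i.succAbove a) j
      · simpa using hB a b
  · ext a b
    simp

theorem Contains.of_tildeM {I J : Type*} {μ : Matrix I J (Set ℝ)} {A : Matrix I J ℝ}
    (hA : Contains (tildeM μ) A) : Contains μ A := by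
  intro i j
  have h := hA i j
  by_cases hij : μ i j = Set.univ
  · simp [hij]
  · simpa [tildeM, hij] using h

/-- If all minors complementary to unbounded entries vanish, then zeroing unbounded entries
does not change the determinant. -/
theorem Contains.det_zero_entries_eq {p : ℕ}
    {μ : Matrix (Fin (p + 1)) (Fin (p + 1)) (Set ℝ)}
    (h : ∀ i j, μ i j = Set.univ →
      ∀ B, Contains (μ.submatrix i.succAbove j.succAbove) B → B.det = 0)
    {A : Matrix (Fin (p + 1)) (Fin (p + 1)) ℝ} (hA : Contains μ A)
    (S : Finset (Fin (p + 1) × Fin (p + 1))) (hS : ∀ x ∈ S, μ x.1 x.2 = Set.univ) :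
    (Matrix.of fun i j => if (i, j) ∈ S then 0 else A i j).det = A.det := by
  induction S using Finset.induction_on with
  | empty => simp only [Finset.notMem_empty, if_false]; rfl
  | insert x S _ ih =>
    obtain ⟨i, j⟩ := x
    rw [← ih fun x hx => hS x (Finset.mem_insert_of_mem hx), ← sub_eq_zero,
      Matrix.det_sub_det_of_eq_off_entry i j, h i j (hS (i, j) (Finset.mem_insert_self _ _)),
      mul_zero]
    · intro a b
      simp only [Matrix.submatrix_apply, Matrix.of_apply]
      split_ifs with hm
      · simp [hS _ hm]
      · exact hA _ _
    · intro k l hkl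
      simp only [Matrix.of_apply, Finset.mem_insert, hkl, false_or]

/-- **Reduction of full rank to the matrix `μ̃`.** A `(p+1) × (p+1)` general closed
interval matrix `μ` is full-rank (every contained real matrix has nonzero determinant) iff
`μ̃` is full-rank and, for every entry `(i,j)` with `μ i j = (-∞, +∞)`, the maximal rank
of the matrix obtained from `μ` by deleting row `i` and column `j` is `< p`. -/
theorem fullRank_iff_tilde (p : ℕ) (μ : Matrix (Fin (p + 1)) (Fin (p + 1)) (Set ℝ))
    (hμ : GCIM μ) :
    (∀ A : Matrix (Fin (p + 1)) (Fin (p + 1)) ℝ, Contains μ A → A.det ≠ 0) ↔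
    ((∀ A : Matrix (Fin (p + 1)) (Fin (p + 1)) ℝ, Contains (tildeM μ) A → A.det ≠ 0) ∧
     ∀ i j, μ i j = Set.univ → Mrk (μ.submatrix i.succAbove j.succAbove) < p) := by
  have hne : ∀ i j, (μ i j).Nonempty := fun i j => (hμ i j).2.1
  have hminor : ∀ i j, Mrk (μ.submatrix (Fin.succAbove i) (Fin.succAbove j)) < p ↔
      ∀ B, Contains (μ.submatrix i.succAbove j.succAbove) B → B.det = 0 :=
    fun i j => Mrk_lt_iff_forall_det_eq_zero fun _ _ => hne _ _
  simp only [hminor]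
  constructor
  · intro h
    refine ⟨fun A hA => h A hA.of_tildeM, fun i j hij B hB => ?_⟩
    by_contra hdet
    obtain ⟨A, hA, rfl⟩ := hB.exists_extension hne
    set m := (A.submatrix i.succAbove j.succAbove).det with hm
    set s : ℝ := (-1) ^ (i + j : ℕ) with hs
    have hs0 : s ≠ 0 := pow_ne_zero _ (by norm_num)
    let x : ℝ := A i j - A.det / (s * m)
    let A' : Matrix (Fin (p + 1)) (Fin (p + 1)) ℝ :=
      Matrix.of fun k l => if (k, l) = (i, j) then x else A k l
    have hx : A' i j = x := by simp [A']
    have hoff : ∀ k l, (k, l) ≠ (i, j) → A k l = A' k l := by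
      intro k l hkl
      simp only [A', Matrix.of_apply, if_neg hkl]
    refine h A' (fun k l => ?_) ?_
    · by_cases hkl : (k, l) = (i, j)
      · obtain ⟨rfl, rfl⟩ := Prod.ext_iff.1 hkl
        simp [hij]
      · exact hoff k l hkl ▸ hA k l
    · have key := Matrix.det_sub_det_of_eq_off_entry i j hoff
      rw [← hm, ← hs, hx, sub_sub_cancel] at key
      have hcancel : s * (A.det / (s * m)) * m = A.det := by field_simp
      linarith
  · rintro ⟨h, hzero⟩ A hA
    let S : Finset (Fin (p + 1) × Fin (p + 1)) := {x | μ x.1 x.2 = Set.univ}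
    rw [← hA.det_zero_entries_eq hzero S fun x hx => by simpa [S] using hx]
    refine h _ fun i j => ?_
    by_cases hij : μ i j = Set.univ
    · simp [tildeM, S, hij]
    · simpa [tildeM, S, hij] using hA i j
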